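/- Model d-dimensional Minkowski space as M = ℝ × E, where E is a real inner product space with dim E ≥ 2 (so d ≥ 3). For each pair 1 ≤ i < j ≤ 4, fix one of the three relations R_{ij} ∈ {x_i → x_j, x_j → x_i, x_i and x_j spacelike separated}. Then the set of quadruples (x₁, x₂, x₃, x₄) ∈ M⁴ satisfying all six chosen relations R_{ij} is a preconnected subset of M⁴ (i.e. connected whenever it is nonempty). -/

import Mathlib

open Set

/-- A fibration-type criterion for preconnectedness. -/
theorem LC_fib {X Y : Type*} [TopologicalSpace X] [TopologicalSpace Y] {A : Set X}
    (hA : IsPreconnected A) (F : X → Set Y) (hopen : IsOpen {z : X × Y | z.2 ∈ F z.1})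
    (hne : ∀ x ∈ A, (F x).Nonempty) (hc : ∀ x ∈ A, IsPreconnected (F x)) :
    IsPreconnected {z : X × Y | z.1 ∈ A ∧ z.2 ∈ F z.1} := by
  intro u v hu hv hcov ⟨z, hz, hzu⟩ ⟨w, hw, hwv⟩
  have hou : IsOpen (Prod.fst '' (u ∩ {z : X × Y | z.2 ∈ F z.1})) :=
    isOpenMap_fst _ (hu.inter hopen)
  have hov : IsOpen (Prod.fst '' (v ∩ {z : X × Y | z.2 ∈ F z.1})) :=
    isOpenMap_fst _ (hv.inter hopen)
  obtain ⟨x, hx, ⟨a, ⟨ha, ha'⟩, rfl⟩, ⟨b, ⟨hb, hb'⟩, hab⟩⟩ := hA _ _ hou hov (by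
      intro x hx
      obtain ⟨y, hy⟩ := hne x hx
      rcases hcov (show (x, y) ∈ _ from ⟨hx, hy⟩) with h | h
      · exact Or.inl ⟨(x, y), ⟨h, hy⟩, rfl⟩
      · exact Or.inr ⟨(x, y), ⟨h, hy⟩, rfl⟩)
    ⟨z.1, hz.1, z, ⟨hzu, hz.2⟩, rfl⟩ ⟨w.1, hw.1, w, ⟨hwv, hw.2⟩, rfl⟩
  have hcont : Continuous (fun y : Y => (a.1, y)) := by fun_prop
  have hp := (hc a.1 hx).image _ hcont.continuousOn
  obtain ⟨c, ⟨y, hy, rfl⟩, h2⟩ := hp u v hu hv (by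
      rintro _ ⟨y, hy, rfl⟩
      exact hcov (show (a.1, y) ∈ _ from ⟨hx, hy⟩)) ⟨a, ⟨a.2, ha', rfl⟩, ha⟩
      ⟨b, ⟨b.2, by simpa [← hab] using hb', by rw [← hab]⟩, hb⟩
  exact ⟨(a.1, y), ⟨hx, hy⟩, h2⟩

/-- Extending rays: a point outside a set star-shaped about `c` is joined to a far sphere. -/
theorem LC_star_compl {E : Type*} [NormedAddCommGroup E] [NormedSpace ℝ E]
    (h : 1 < Module.rank ℝ E) {B : Set E} {c : E} (hcB : c ∈ B) (hB : StarConvex ℝ c B)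
    (hbd : Bornology.IsBounded B) : IsPreconnected Bᶜ := by
  obtain ⟨r, hr⟩ := hbd.subset_ball c
  apply isPreconnected_of_forall_pair
  intro x hx y hy
  set M := max r (max ‖x - c‖ ‖y - c‖) with hM
  have key : ∀ z, z ∉ B → ‖z - c‖ ≤ M →
      segment ℝ z (c + (M / ‖z - c‖) • (z - c)) ⊆ Bᶜ ∧
      c + (M / ‖z - c‖) • (z - c) ∈ Metric.sphere c M := by
    intro z hz hzM
    have hzc : z - c ≠ 0 := by
      intro h0
      exact hz (by rwa [sub_eq_zero.1 h0])
    have hpos : 0 < ‖z - c‖ := norm_pos_iff.2 hzc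
    have hl : 1 ≤ M / ‖z - c‖ := by rwa [le_div_iff₀ hpos, one_mul]
    constructor
    · rintro w ⟨a, b, ha, hb, hab, rfl⟩ hw
      apply hz
      set l := a + b * (M / ‖z - c‖) with hldef
      have hl1 : 1 ≤ l := by nlinarith
      have hw' : a • z + b • (c + (M / ‖z - c‖) • (z - c)) = c + l • (z - c) := by
        have ha1 : a = 1 - b := by linarith
        rw [hldef, ha1]
        module
      rw [hw'] at hw
      have h1 := (starConvex_iff_forall_pos hcB).1 hB hw
      rcases eq_or_lt_of_le hl1 with h2 | h2
      · rw [← h2] at hw; simpa using hw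
      · have hl0 : 0 < l := by linarith
        have h3 := h1 (a := 1 - l⁻¹) (b := l⁻¹)
          (by have := inv_lt_one_of_one_lt₀ h2; linarith) (by positivity) (by ring)
        convert h3 using 1
        rw [smul_add, smul_smul, inv_mul_cancel₀ hl0.ne']
        module
    · simp only [Metric.mem_sphere, dist_eq_norm, add_sub_cancel_left, norm_smul, norm_div,
        norm_norm]
      rw [div_mul_cancel₀ _ hpos.ne', Real.norm_of_nonneg (hpos.le.trans hzM)]
  have hxM : ‖x - c‖ ≤ M := (le_max_left _ _).trans (le_max_right _ _)
  have hyM : ‖y - c‖ ≤ M := (le_max_right _ _).trans (le_max_right _ _)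
  obtain ⟨kx, kx'⟩ := key x hx hxM
  obtain ⟨ky, ky'⟩ := key y hy hyM
  have hs : Metric.sphere c M ⊆ Bᶜ := by
    intro z hz hzB
    have := hr hzB
    rw [Metric.mem_ball] at this
    rw [Metric.mem_sphere] at hz
    have : r ≤ M := le_max_left _ _
    linarith
  refine ⟨(segment ℝ x (c + (M / ‖x - c‖) • (x - c)) ∪ Metric.sphere c M) ∪
    segment ℝ y (c + (M / ‖y - c‖) • (y - c)), union_subset (union_subset kx hs) ky,
    Or.inl (Or.inl (left_mem_segment _ _ _)), Or.inr (left_mem_segment _ _ _), ?_⟩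
  refine IsPreconnected.union _ (Or.inr ky') (right_mem_segment _ _ _) ?_
    (convex_segment _ _).isPreconnected
  exact IsPreconnected.union _ (right_mem_segment _ _ _) kx'
    (convex_segment _ _).isPreconnected (isPreconnected_sphere h _ _)

/-- Punctured balls are preconnected. -/
theorem LC_punctured {E : Type*} [NormedAddCommGroup E] [NormedSpace ℝ E]
    (h : 1 < Module.rank ℝ E) (a : E) {r : ℝ} :
    IsPreconnected (Metric.ball a r \ {a}) := by
  have : Metric.ball a r \ {a} = (fun z : ℝ × E => a + z.1 • z.2) ''
      (Ioo 0 r ×ˢ Metric.sphere (0 : E) 1) := by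
    ext x
    simp only [mem_sdiff, Metric.mem_ball, mem_singleton_iff, mem_image, mem_prod, mem_Ioo,
      Metric.mem_sphere, dist_eq_norm, sub_zero, Prod.exists]
    constructor
    · rintro ⟨h1, h2⟩
      have hpos : 0 < ‖x - a‖ := norm_pos_iff.2 (sub_ne_zero.2 h2)
      refine ⟨‖x - a‖, ‖x - a‖⁻¹ • (x - a), ⟨⟨hpos, h1⟩, ?_⟩, ?_⟩
      · rw [norm_smul, norm_inv, norm_norm, inv_mul_cancel₀ hpos.ne']
      · rw [smul_smul, mul_inv_cancel₀ hpos.ne']; simp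
    · rintro ⟨t, u, ⟨⟨h1, h2⟩, h3⟩, rfl⟩
      have hu : u ≠ 0 := by rintro rfl; simp at h3
      refine ⟨?_, by simp [hu, h1.ne']⟩
      simp [norm_smul, h3, abs_of_pos h1, h2]
  rw [this]
  exact (isPreconnected_Ioo.prod (isPreconnected_sphere h _ _)).image _ (by fun_prop)

theorem LC_diff_singleton {E : Type*} [NormedAddCommGroup E] [NormedSpace ℝ E]
    (h : 1 < Module.rank ℝ E) {U : Set E} (hU : IsOpen U) (hc : IsPreconnected U) (a : E) :
    IsPreconnected (U \ {a}) := by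
  by_cases haU : a ∈ U
  swap
  · rwa [sdiff_singleton_eq_self haU]
  obtain ⟨r, hr0, hr⟩ := Metric.isOpen_iff.1 hU a haU
  have hp := LC_punctured h a (r := r)
  have : Nontrivial E := (rank_pos_iff_nontrivial (R := ℝ)).1 (zero_lt_one.trans h)
  rw [isPreconnected_iff_subset_of_disjoint] at hp ⊢
  have main : ∀ u v : Set E, IsOpen u → IsOpen v → U \ {a} ⊆ u ∪ v →
      U \ {a} ∩ (u ∩ v) = ∅ → Metric.ball a r \ {a} ⊆ u → U \ {a} ⊆ u ∨ U \ {a} ⊆ v := by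
    intro u v hu hv hcov hdis hsub
    have h1 := isPreconnected_iff_subset_of_disjoint.1 hc (u ∪ Metric.ball a r) (v \ {a})
      (hu.union Metric.isOpen_ball) (hv.sdiff isClosed_singleton) (by
        intro x hx
        by_cases hxa : x = a
        · exact Or.inl (Or.inr (by simp [hxa, hr0]))
        · rcases hcov ⟨hx, hxa⟩ with h | h
          · exact Or.inl (Or.inl h)
          · exact Or.inr ⟨h, hxa⟩) (by
        rw [eq_empty_iff_forall_notMem] at hdis ⊢
        rintro x ⟨hx, h1, h2, h3⟩
        refine hdis x ⟨⟨hx, h3⟩, ?_, h2⟩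
        rcases h1 with h1 | h1
        · exact h1
        · exact hsub ⟨h1, h3⟩)
    rcases h1 with h1 | h1
    · left
      rintro x ⟨hx, hxa⟩
      rcases h1 hx with h | h
      · exact h
      · exact hsub ⟨h, hxa⟩
    · exact absurd rfl (h1 haU).2
  intro u v hu hv hcov hdis
  have hbs : Metric.ball a r \ {a} ⊆ U \ {a} := sdiff_subset_sdiff_left hr
  rcases hp u v hu hv (hbs.trans hcov) (by
    rw [← subset_empty_iff, ← hdis]
    exact inter_subset_inter_left _ hbs) with h1 | h1
  · exact main u v hu hv hcov hdis h1
  · exact (main v u hv hu (by rwa [union_comm]) (by rwa [inter_comm v u]) h1).symm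

theorem LC_diff_finite {E : Type*} [NormedAddCommGroup E] [NormedSpace ℝ E]
    (h : 1 < Module.rank ℝ E) {U : Set E} (hU : IsOpen U) (hc : IsPreconnected U) (s : Finset E) :
    IsPreconnected (U \ (s : Set E)) := by
  classical
  induction s using Finset.induction_on with
  | empty => simpa
  | insert a s ha ih =>
    have : U \ ((insert a s : Finset E) : Set E) = (U \ (s : Set E)) \ {a} := by
      ext x; simp only [Finset.coe_insert, mem_sdiff, mem_insert_iff, mem_singleton_iff]; tauto
    rw [this]
    exact LC_diff_singleton h (hU.sdiff s.finite_toSet.isClosed) ih a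
def LCGood (lt : Fin 4 → Fin 4 → Bool) (s : Finset (Fin 4)) (m : Fin 4) : Prop :=
  (∀ i ∈ s, lt m i = false) ∧
  ((∃ a ∈ s, lt a m = true ∧ ∀ q ∈ s, lt q m = false →
      (lt a q = false ∧ lt q a = false) ∧ ∀ p ∈ s, lt p m = true → p = a ∨ lt p q = true) ∨
   ((∀ p ∈ s, lt p m = true → ∀ q ∈ s, lt q m = false → lt p q = true) ∧
    ((∀ q ∈ s, lt q m = true) ∨
     ∃ c ∈ s, lt c m = false ∧ ∀ q ∈ s, lt q m = false →
      (q = c ∨ lt q c = true ∨ lt c q = true) ∨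
      (∀ r ∈ s, lt r m = false → r = q ∨ (lt q r = false ∧ lt r q = false)))))

def LCall4 (f : Fin 4 → Bool) : Bool := f 0 && (f 1 && (f 2 && f 3))
def LCany4 (f : Fin 4 → Bool) : Bool := f 0 || (f 1 || (f 2 || f 3))
def LCimp (a b : Bool) : Bool := !a || b
def LCgoodB (lt : Fin 4 → Fin 4 → Bool) (s : Fin 4 → Bool) (m : Fin 4) : Bool :=
  LCall4 (fun i => LCimp (s i) (!lt m i)) &&
  (LCany4 (fun a => s a && (lt a m && LCall4 fun q => LCimp (s q) (LCimp (!lt q m)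
      ((!lt a q && !lt q a) && LCall4 fun p => LCimp (s p) (LCimp (lt p m) (p == a || lt p q)))))) ||
   (LCall4 (fun p => LCimp (s p) (LCimp (lt p m) (LCall4 fun q => LCimp (s q) (LCimp (!lt q m) (lt p q))))) &&
    (LCall4 (fun q => LCimp (s q) (lt q m)) ||
     LCany4 fun c => s c && (!lt c m && LCall4 fun q => LCimp (s q) (LCimp (!lt q m) (
      (q == c || (lt q c || lt c q)) ||
      LCall4 fun r => LCimp (s r) (LCimp (!lt r m) (r == q || (!lt q r && !lt r q)))))))))
def LCltOf (a b c d e f : Fin 3) (i j : Fin 4) : Bool :=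
  match i, j with
  | 0, 1 => a == 0 | 1, 0 => a == 1
  | 0, 2 => b == 0 | 2, 0 => b == 1
  | 0, 3 => c == 0 | 3, 0 => c == 1
  | 1, 2 => d == 0 | 2, 1 => d == 1
  | 1, 3 => e == 0 | 3, 1 => e == 1
  | 2, 3 => f == 0 | 3, 2 => f == 1
  | _, _ => false
def LCmask (a b c d : Bool) (i : Fin 4) : Bool := match i with | 0 => a | 1 => b | 2 => c | 3 => d
theorem LC_combB : ∀ a b c d e f : Fin 3,
  (LCall4 fun i => LCall4 fun j => LCimp (LCltOf a b c d e f i j) (LCall4 fun k => LCimp (LCltOf a b c d e f j k) (LCltOf a b c d e f i k))) = true →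
  ∀ w x y z : Bool, LCany4 (LCmask w x y z) = true → LCany4 (fun m => LCmask w x y z m && (LCgoodB (LCltOf a b c d e f) (fun i => LCmask w x y z i && !(i == m)) m || LCgoodB (fun i j => LCltOf a b c d e f j i) (fun i => LCmask w x y z i && !(i == m)) m)) = true := by
  decide +kernel

theorem LCall4_iff (f : Fin 4 → Bool) : LCall4 f = true ↔ ∀ i, f i = true := by
  simp [LCall4, Fin.forall_fin_succ]

theorem LCany4_iff (f : Fin 4 → Bool) : LCany4 f = true ↔ ∃ i, f i = true := by
  simp [LCany4, Fin.exists_fin_succ]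

theorem LCimp_iff (a b : Bool) : LCimp a b = true ↔ (a = true → b = true) := by
  cases a <;> cases b <;> decide

theorem LCgood_of_goodB (lt : Fin 4 → Fin 4 → Bool) (s : Finset (Fin 4)) (m : Fin 4)
    (h : LCgoodB lt (fun i => decide (i ∈ s)) m = true) : LCGood lt s m := by
  simpa only [LCgoodB, LCGood, Bool.and_eq_true, Bool.or_eq_true, LCall4_iff, LCany4_iff, LCimp_iff,
    decide_eq_true_eq, Bool.not_eq_true', beq_iff_eq] using h

theorem LC_comb (a b c d e f : Fin 3)
    (htr : ∀ i j : Fin 4, LCltOf a b c d e f i j = true → ∀ k, LCltOf a b c d e f j k = true →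
      LCltOf a b c d e f i k = true) (t : Finset (Fin 4)) (ht : t.Nonempty) :
    ∃ m ∈ t, LCGood (LCltOf a b c d e f) (t.erase m) m ∨
      LCGood (fun i j => LCltOf a b c d e f j i) (t.erase m) m := by
  have hmask : LCmask (decide (0 ∈ t)) (decide (1 ∈ t)) (decide (2 ∈ t)) (decide (3 ∈ t)) =
      fun i => decide (i ∈ t) := by
    funext i
    fin_cases i <;> rfl
  have key := LC_combB a b c d e f (by simpa only [LCall4_iff, LCimp_iff] using htr)
    (decide (0 ∈ t)) (decide (1 ∈ t)) (decide (2 ∈ t)) (decide (3 ∈ t))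
    (by
      rw [hmask, LCany4_iff]
      obtain ⟨i, hi⟩ := ht
      exact ⟨i, by simpa using hi⟩)
  rw [hmask, LCany4_iff] at key
  obtain ⟨m, hm⟩ := key
  rw [Bool.and_eq_true, Bool.or_eq_true, decide_eq_true_eq] at hm
  have he : (fun i => decide (i ∈ t) && !(i == m)) = fun i => decide (i ∈ t.erase m) := by
    funext i
    rw [Bool.eq_iff_iff]
    simp [and_comm]
  rw [he] at hm
  exact ⟨m, hm.1, hm.2.imp (LCgood_of_goodB _ _ _) (LCgood_of_goodB _ _ _)⟩

theorem LC_exists_t {ι : Type*} (s : Finset ι) (P : ι → Bool) (τ n : ι → ℝ)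
    (h1 : ∀ p ∈ s, P p = true → ∀ q ∈ s, P q = false → τ p + n p < τ q + n q)
    (h2 : ∀ p ∈ s, P p = false → ∀ q ∈ s, P q = false → τ p - n p < τ q + n q) :
    ∃ t : ℝ, ∀ i ∈ s, (P i = true → n i < t - τ i) ∧ (P i = false → |t - τ i| < n i) := by
  classical
  obtain ⟨t, ht1, ht2⟩ := Order.exists_between_finsets
    (s.image (fun i => if P i = true then τ i + n i else τ i - n i))
    ((s.filter (fun i => P i = false)).image (fun i => τ i + n i)) (by
      intro x hx y hy
      simp only [Finset.mem_image, Finset.mem_filter] at hx hy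
      obtain ⟨p, hp, rfl⟩ := hx
      obtain ⟨q, ⟨hq, hq'⟩, rfl⟩ := hy
      by_cases hP : P p = true
      · simpa [hP] using h1 p hp hP q hq hq'
      · simpa [hP] using h2 p hp (by simpa using hP) q hq hq')
  refine ⟨t, fun i hi => ⟨fun hP => ?_, fun hP => ?_⟩⟩
  · have := ht1 _ (Finset.mem_image_of_mem _ hi)
    simp only [hP, if_true] at this
    linarith
  · have a1 := ht1 _ (Finset.mem_image_of_mem _ hi)
    have a2 := ht2 _ (Finset.mem_image_of_mem _ (Finset.mem_filter.2 ⟨hi, hP⟩))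
    simp only [hP] at a1
    simp only [Bool.false_eq_true, if_false] at a1
    rw [abs_lt]
    constructor <;> linarith

section
variable {E : Type*} [NormedAddCommGroup E] [InnerProductSpace ℝ E]

/-- Configurations whose points indexed by `s` have the causal ordering `lt`. -/
def LCConf (E : Type*) [NormedAddCommGroup E] (lt : Fin 4 → Fin 4 → Bool) (s : Finset (Fin 4)) :
    Set (Fin 4 → ℝ × E) :=
  {p | ∀ i ∈ s, ∀ j ∈ s, i ≠ j →
    (lt i j = true → ‖(p j).2 - (p i).2‖ < (p j).1 - (p i).1) ∧
    (lt i j = false → lt j i = false → |(p i).1 - (p j).1| < ‖(p i).2 - (p j).2‖)}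

/-- Possible positions of a new maximal point `m` over a configuration `p`. -/
def LCFib (lt : Fin 4 → Fin 4 → Bool) (s : Finset (Fin 4)) (m : Fin 4) (p : Fin 4 → ℝ × E) :
    Set (ℝ × E) :=
  {y | ∀ i ∈ s, (lt i m = true → ‖y.2 - (p i).2‖ < y.1 - (p i).1) ∧
    (lt i m = false → |y.1 - (p i).1| < ‖y.2 - (p i).2‖)}

theorem LC_open_total (lt : Fin 4 → Fin 4 → Bool) (s : Finset (Fin 4)) (m : Fin 4) :
    IsOpen {z : (Fin 4 → ℝ × E) × (ℝ × E) | z.2 ∈ LCFib lt s m z.1} := by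
  simp only [LCFib, mem_ofPred_eq]
  have : {z : (Fin 4 → ℝ × E) × (ℝ × E) | ∀ i ∈ s,
      (lt i m = true → ‖z.2.2 - (z.1 i).2‖ < z.2.1 - (z.1 i).1) ∧
      (lt i m = false → |z.2.1 - (z.1 i).1| < ‖z.2.2 - (z.1 i).2‖)} =
    ⋂ i ∈ s, {z : (Fin 4 → ℝ × E) × (ℝ × E) |
      (lt i m = true → ‖z.2.2 - (z.1 i).2‖ < z.2.1 - (z.1 i).1) ∧
      (lt i m = false → |z.2.1 - (z.1 i).1| < ‖z.2.2 - (z.1 i).2‖)} := by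
    ext z; simp
  rw [this]
  refine isOpen_biInter_finset fun i _ => ?_
  cases lt i m
  · simp only [Bool.false_eq_true, false_imp_iff, true_and, forall_const]
    exact isOpen_lt (by fun_prop) (by fun_prop)
  · simp only [Bool.true_eq_false, false_imp_iff, and_true, forall_const]
    exact isOpen_lt (by fun_prop) (by fun_prop)

/-- The fibre is connected as soon as its spatial shadow `U` is. -/
theorem LC_fib_of_shadow (lt : Fin 4 → Fin 4 → Bool) (s : Finset (Fin 4)) (m : Fin 4)
    (p : Fin 4 → ℝ × E) (U : Set E) (hU : IsConnected U)
    (h1 : ∀ y ∈ LCFib lt s m p, y.2 ∈ U)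
    (h2 : ∀ x ∈ U, ∃ t, (t, x) ∈ LCFib lt s m p) : IsConnected (LCFib lt s m p) := by
  constructor
  · obtain ⟨x, hx⟩ := hU.1
    obtain ⟨t, ht⟩ := h2 x hx
    exact ⟨_, ht⟩
  have hopen : IsOpen {z : E × ℝ | z.2 ∈ {t : ℝ | (t, z.1) ∈ LCFib lt s m p}} :=
    (LC_open_total lt s m).preimage (f := fun z : E × ℝ => (p, (z.2, z.1))) (by fun_prop)
  have key := LC_fib hU.2 (fun x => {t : ℝ | (t, x) ∈ LCFib lt s m p}) hopen h2 (by
    intro x _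
    apply Set.OrdConnected.isPreconnected
    constructor
    intro a ha b hb c hc i hi
    have ha' := ha i hi
    have hb' := hb i hi
    rw [mem_Icc] at hc
    simp only [abs_lt] at ha' hb' ⊢
    refine ⟨fun h => ?_, fun h => ?_⟩
    · have := ha'.1 h; linarith
    · have := ha'.2 h; have := hb'.2 h; constructor <;> linarith)
  have := key.image (fun z : E × ℝ => (z.2, z.1)) (by fun_prop)
  convert this using 1
  ext y
  constructor
  · intro hy
    exact ⟨(y.2, y.1), ⟨h1 y hy, hy⟩, rfl⟩
  · rintro ⟨z, ⟨_, hz⟩, rfl⟩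
    exact hz

theorem LC_tri {x a b : E} : ‖a - b‖ ≤ ‖x - a‖ + ‖x - b‖ := by
  have h : a - b = (x - b) - (x - a) := by abel
  rw [h, add_comm]
  exact norm_sub_le _ _

/-- Case I: the shadow is star-shaped. -/
theorem LC_caseI (lt : Fin 4 → Fin 4 → Bool) (s : Finset (Fin 4)) (m : Fin 4)
    (p : Fin 4 → ℝ × E) (hp : p ∈ LCConf E lt s) (a : Fin 4) (has : a ∈ s) (ham : lt a m = true)
    (h : ∀ q ∈ s, lt q m = false → (lt a q = false ∧ lt q a = false) ∧
      ∀ p ∈ s, lt p m = true → p = a ∨ lt p q = true) : IsConnected (LCFib lt s m p) := by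
  have hspace : ∀ q ∈ s, lt q m = false → |(p a).1 - (p q).1| < ‖(p a).2 - (p q).2‖ := by
    intro q hq hqm
    exact (hp a has q hq (by rintro rfl; simp [ham] at hqm)).2 (h q hq hqm).1.1 (h q hq hqm).1.2
  let U : Set E := {x | ∀ q ∈ s, lt q m = false →
      (p a).1 + ‖x - (p a).2‖ < (p q).1 + ‖x - (p q).2‖}
  have haU : (p a).2 ∈ U := by
    intro q hq hqm
    have := abs_lt.1 (hspace q hq hqm)
    simp only [sub_self, norm_zero]
    linarith
  have hstar : StarConvex ℝ (p a).2 U := by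
    rw [starConvex_iff_forall_pos haU]
    intro x hx b c hb hc hbc q hq hqm
    have h1 := hx q hq hqm
    have hb' : b = 1 - c := by linarith
    set z := b • (p a).2 + c • x with hz
    have e1 : z - (p a).2 = c • (x - (p a).2) := by rw [hz, hb']; module
    have e2 : x - z = b • (x - (p a).2) := by
      rw [hz, show c = 1 - b by linarith]; module
    have n1 : ‖z - (p a).2‖ = c * ‖x - (p a).2‖ := by
      rw [e1, norm_smul, Real.norm_of_nonneg hc.le]
    have n2 : ‖x - z‖ = b * ‖x - (p a).2‖ := by
      rw [e2, norm_smul, Real.norm_of_nonneg hb.le]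
    have n3 : ‖x - (p q).2‖ ≤ ‖x - z‖ + ‖z - (p q).2‖ := by
      simpa using norm_add_le (x - z) (z - (p q).2)
    rw [n1]
    rw [hb'] at n2
    linarith
  refine LC_fib_of_shadow lt s m p U (hstar.isPathConnected haU).isConnected ?_ ?_
  · intro y hy q hq hqm
    have h1 := (hy a has).1 ham
    have h2 := abs_lt.1 ((hy q hq).2 hqm)
    linarith
  · intro x hx
    refine LC_exists_t s (fun i => lt i m) (fun i => (p i).1) (fun i => ‖x - (p i).2‖) ?_ ?_
    · intro i hi him q hq hqm
      rcases (h q hq hqm).2 i hi him with rfl | hiq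
      · exact hx q hq hqm
      · have hne : i ≠ q := by rintro rfl; simp [him] at hqm
        have h1 := (hp i hi q hq hne).1 hiq
        have h2 : ‖x - (p i).2‖ ≤ ‖x - (p q).2‖ + ‖(p q).2 - (p i).2‖ := by
          simpa using norm_add_le (x - (p q).2) ((p q).2 - (p i).2)
        linarith
    · intro i hi him q hq hqm
      have h1 := hx q hq hqm
      have h2 := abs_lt.1 (hspace i hi him)
      have h3 := LC_tri (x := x) (a := (p a).2) (b := (p i).2)
      linarith

/-- Case II: the shadow is the complement of a bounded star-shaped set and a finite set. -/
theorem LC_caseII (hdim : 1 < Module.rank ℝ E)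
    (lt : Fin 4 → Fin 4 → Bool) (s : Finset (Fin 4)) (m : Fin 4)
    (p : Fin 4 → ℝ × E) (hp : p ∈ LCConf E lt s)
    (h : ∀ p ∈ s, lt p m = true → ∀ q ∈ s, lt q m = false → lt p q = true)
    (h' : (∀ q ∈ s, lt q m = true) ∨
     ∃ c ∈ s, lt c m = false ∧ ∀ q ∈ s, lt q m = false →
      (q = c ∨ lt q c = true ∨ lt c q = true) ∨
      (∀ r ∈ s, lt r m = false → r = q ∨ (lt q r = false ∧ lt r q = false))) :
    IsConnected (LCFib lt s m p) := by
  classical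
  have : Nontrivial E := (rank_pos_iff_nontrivial (R := ℝ)).1 (zero_lt_one.trans hdim)
  let U : Set E := {x | ∀ q ∈ s, lt q m = false → ∀ r ∈ s, lt r m = false →
      (p q).1 - (p r).1 < ‖x - (p q).2‖ + ‖x - (p r).2‖}
  have hU : IsConnected U := by
    rcases h' with h' | ⟨c, hcs, hcm, hc⟩
    · have : U = univ := by
        ext x
        simp only [U, mem_ofPred_eq, mem_univ, iff_true]
        intro q hq hqm
        simp [h' q hq] at hqm
      rw [this]
      exact isConnected_univ
    let C : Finset (Fin 4) := s.filter fun q => lt q m = false ∧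
      (q = c ∨ lt q c = true ∨ lt c q = true)
    let I : Finset (Fin 4) := s.filter fun q => lt q m = false
    have hC : ∀ q, q ∈ C ↔ q ∈ s ∧ lt q m = false ∧ (q = c ∨ lt q c = true ∨ lt c q = true) := by
      intro q; simp [C]
    have hcC : c ∈ C := (hC c).2 ⟨hcs, hcm, Or.inl rfl⟩
    let D : Fin 4 → Fin 4 → Set E := fun q r =>
      {x | ‖x - (p q).2‖ + ‖x - (p r).2‖ ≤ (p q).1 - (p r).1}
    have hDconv : ∀ q r, Convex ℝ (D q r) := by
      intro q r
      have := (convexOn_dist (p q).2 (convex_univ (𝕜 := ℝ))).add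
        (convexOn_dist (p r).2 (convex_univ (𝕜 := ℝ)))
      simpa [D, dist_eq_norm] using this.convex_le ((p q).1 - (p r).1)
    have hDclosed : ∀ q r, IsClosed (D q r) := fun q r =>
      isClosed_le (by fun_prop) (by fun_prop)
    have hDbd : ∀ q r, Bornology.IsBounded (D q r) := by
      intro q r
      refine Metric.isBounded_closedBall.subset (s := D q r)
        (t := Metric.closedBall (p q).2 ((p q).1 - (p r).1)) ?_
      intro x hx
      rw [Metric.mem_closedBall, dist_eq_norm]
      have : ‖x - (p q).2‖ + ‖x - (p r).2‖ ≤ (p q).1 - (p r).1 := hx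
      have := norm_nonneg (x - (p r).2)
      linarith
    let B : Set E := ⋃ q ∈ C, ⋃ r ∈ C, D q r
    have hBmem : ∀ x, x ∈ B ↔ ∃ q ∈ C, ∃ r ∈ C, x ∈ D q r := by
      intro x; simp [B]
    have hBclosed : IsClosed B := by
      refine C.finite_toSet.isClosed_biUnion fun q _ => C.finite_toSet.isClosed_biUnion fun r _ =>
        hDclosed q r
    have hBbd : Bornology.IsBounded B := by
      refine (Bornology.isBounded_biUnion C.finite_toSet).2 fun q _ =>
        (Bornology.isBounded_biUnion C.finite_toSet).2 fun r _ => hDbd q r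
    have hcB : (p c).2 ∈ B := (hBmem _).2 ⟨c, hcC, c, hcC, by simp [D]⟩
    have hDlt : ∀ q ∈ s, ∀ r ∈ s, q ≠ r → lt r q = true → (p q).2 ∈ D q r ∧ (p r).2 ∈ D q r := by
      intro q hq r hr hne hlt
      have h1 := (hp r hr q hq hne.symm).1 hlt
      have h2 := norm_sub_rev (p q).2 (p r).2
      constructor
      · simp only [D, mem_ofPred_eq, sub_self, norm_zero]; linarith
      · simp only [D, mem_ofPred_eq, sub_self, norm_zero]; linarith
    -- a point of some `D q r` forces `q = r` or `r < q`
    have hDrel : ∀ q ∈ s, ∀ r ∈ s, ∀ x, x ∈ D q r → q = r ∨ lt r q = true := by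
      intro q hq r hr x hx
      by_contra! hcon
      obtain ⟨hne, hrq⟩ := hcon
      have hrq : lt r q = false := by simpa using hrq
      have hx : ‖x - (p q).2‖ + ‖x - (p r).2‖ ≤ (p q).1 - (p r).1 := hx
      have ht := LC_tri (x := x) (a := (p q).2) (b := (p r).2)
      cases hqr : lt q r
      · have := abs_lt.1 ((hp q hq r hr hne).2 hqr hrq)
        linarith
      · have := (hp q hq r hr hne).1 hqr
        have := norm_nonneg ((p r).2 - (p q).2)
        have := norm_nonneg ((p q).2 - (p r).2)
        linarith
    have hkey : ∀ x ∈ B, ∃ q ∈ C, ∃ r ∈ C, x ∈ D q r ∧ (p c).2 ∈ D q r := by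
      intro x hx
      obtain ⟨q, hq, r, hr, hxD⟩ := (hBmem x).1 hx
      obtain ⟨hqs, hqm, hqc⟩ := (hC q).1 hq
      obtain ⟨hrs, hrm, hrc⟩ := (hC r).1 hr
      have hx' : ‖x - (p q).2‖ + ‖x - (p r).2‖ ≤ (p q).1 - (p r).1 := hxD
      have hnn := norm_nonneg (x - (p q).2)
      have hnn' := norm_nonneg (x - (p r).2)
      by_cases hqc0 : q = c
      · subst hqc0
        by_cases hrq : q = r
        · subst hrq
          exact ⟨q, hq, q, hq, hxD, by simp [D]⟩
        · have hl := (hDrel q hqs r hrs x hxD).resolve_left hrq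
          exact ⟨q, hq, r, hr, hxD, (hDlt q hqs r hrs hrq hl).1⟩
      have hqc := hqc.resolve_left hqc0
      by_cases hrc0 : r = c
      · subst hrc0
        have hl := (hDrel q hqs r hrs x hxD).resolve_left hqc0
        exact ⟨q, hq, r, hr, hxD, (hDlt q hqs r hrs hqc0 hl).2⟩
      have hrc := hrc.resolve_left hrc0
      rcases hqc with hqc | hqc
      · -- `q < c`: enlarge to `D c r`
        have h1 := (hp q hqs c hcs hqc0).1 hqc
        have h2 : ‖x - (p c).2‖ ≤ ‖x - (p q).2‖ + ‖(p c).2 - (p q).2‖ := by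
          rw [norm_sub_rev (p c).2]
          simpa using norm_add_le (x - (p q).2) ((p q).2 - (p c).2)
        have hm : x ∈ D c r := by
          simp only [D, mem_ofPred_eq]; linarith
        have hl := (hDrel c hcs r hrs x hm).resolve_left (fun e => hrc0 e.symm)
        exact ⟨c, hcC, r, hr, hm, (hDlt c hcs r hrs (fun e => hrc0 e.symm) hl).1⟩
      rcases hrc with hrc | hrc
      · -- `r < c < q`
        refine ⟨q, hq, r, hr, hxD, ?_⟩
        have h1 := (hp c hcs q hqs (fun e => hqc0 e.symm)).1 hqc
        have h2 := (hp r hrs c hcs hrc0).1 hrc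
        have h3 := norm_sub_rev (p q).2 (p c).2
        simp only [D, mem_ofPred_eq]
        linarith
      · -- `c < r`: enlarge to `D q c`
        have h1 := (hp c hcs r hrs (fun e => hrc0 e.symm)).1 hrc
        have h2 : ‖x - (p c).2‖ ≤ ‖x - (p r).2‖ + ‖(p r).2 - (p c).2‖ := by
          simpa using norm_add_le (x - (p r).2) ((p r).2 - (p c).2)
        have hm : x ∈ D q c := by
          simp only [D, mem_ofPred_eq]; linarith
        have hl := (hDrel q hqs c hcs x hm).resolve_left hqc0
        exact ⟨q, hq, c, hcC, hm, (hDlt q hqs c hcs hqc0 hl).2⟩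
    have hstar : StarConvex ℝ (p c).2 B := by
      intro x hx a b ha hb hab
      obtain ⟨q, hq, r, hr, h1, h2⟩ := hkey x hx
      exact (hBmem _).2 ⟨q, hq, r, hr, hDconv q r h2 h1 ha hb hab⟩
    have hUeq : U = Bᶜ \ ((I.image fun q => (p q).2 : Finset E) : Set E) := by
      ext x
      constructor
      · intro hx
        refine ⟨fun hxB => ?_, fun hxI => ?_⟩
        · obtain ⟨q, hq, r, hr, hxD⟩ := (hBmem x).1 hxB
          obtain ⟨hqs, hqm, -⟩ := (hC q).1 hq
          obtain ⟨hrs, hrm, -⟩ := (hC r).1 hr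
          have h1 := hx q hqs hqm r hrs hrm
          have h2 : ‖x - (p q).2‖ + ‖x - (p r).2‖ ≤ (p q).1 - (p r).1 := hxD
          linarith
        · simp only [Finset.coe_image, mem_image, Finset.mem_coe, I, Finset.mem_filter] at hxI
          obtain ⟨q, ⟨hqs, hqm⟩, rfl⟩ := hxI
          have := hx q hqs hqm q hqs hqm
          simp at this
      · rintro ⟨hxB, hxI⟩ q hq hqm r hr hrm
        by_contra! hcon
        have hxD : x ∈ D q r := hcon
        have hne : q ≠ r := by
          rintro rfl
          apply hxI
          simp only [Finset.coe_image, mem_image, Finset.mem_coe, I, Finset.mem_filter]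
          refine ⟨q, ⟨hq, hqm⟩, ?_⟩
          have h0 : ‖x - (p q).2‖ ≤ 0 := by linarith
          exact (sub_eq_zero.1 (norm_le_zero_iff.1 h0)).symm
        have hl := (hDrel q hq r hr x hxD).resolve_left hne
        rcases hc q hq hqm with h1 | h1
        · rcases hc r hr hrm with h2 | h2
          · exact hxB ((hBmem x).2 ⟨q, (hC q).2 ⟨hq, hqm, h1⟩, r, (hC r).2 ⟨hr, hrm, h2⟩, hxD⟩)
          · rcases h2 q hq hqm with h3 | h3
            · exact hne h3
            · simp [hl] at h3
        · rcases h1 r hr hrm with h3 | h3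
          · exact hne h3.symm
          · simp [hl] at h3
    constructor
    · rw [hUeq]
      by_contra hemp
      rw [not_nonempty_iff_eq_empty, sdiff_eq_empty] at hemp
      have hb : Bornology.IsBounded (B ∪ ((I.image fun q => (p q).2 : Finset E) : Set E)) :=
        hBbd.union (Finset.finite_toSet _).isBounded
      refine NormedSpace.unbounded_univ ℝ E (hb.subset fun x _ => ?_)
      by_cases hxB : x ∈ B
      · exact Or.inl hxB
      · exact Or.inr (hemp hxB)
    · rw [hUeq]
      exact LC_diff_finite hdim hBclosed.isOpen_compl (LC_star_compl hdim hcB hstar hBbd) _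
  refine LC_fib_of_shadow lt s m p U hU ?_ ?_
  · intro y hy q hq hqm r hr hrm
    have h1 := abs_lt.1 ((hy q hq).2 hqm)
    have h2 := abs_lt.1 ((hy r hr).2 hrm)
    linarith
  · intro x hx
    refine LC_exists_t s (fun i => lt i m) (fun i => (p i).1) (fun i => ‖x - (p i).2‖) ?_ ?_
    · intro i hi him q hq hqm
      have hne : i ≠ q := by rintro rfl; simp [him] at hqm
      have h1 := (hp i hi q hq hne).1 (h i hi him q hq hqm)
      have h2 : ‖x - (p i).2‖ ≤ ‖x - (p q).2‖ + ‖(p q).2 - (p i).2‖ := by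
        simpa using norm_add_le (x - (p q).2) ((p q).2 - (p i).2)
      linarith
    · intro i hi him q hq hqm
      have := hx i hi him q hq hqm
      linarith

theorem LC_step (hdim : 1 < Module.rank ℝ E)
    (lt : Fin 4 → Fin 4 → Bool) (has : ∀ i j, lt i j = true → lt j i = false)
    (t : Finset (Fin 4)) (m : Fin 4) (hm : m ∈ t)
    (hg : LCGood lt (t.erase m) m) (hs : IsPreconnected (LCConf E lt (t.erase m))) :
    IsPreconnected (LCConf E lt t) := by
  have hc : ∀ p ∈ LCConf E lt (t.erase m), IsConnected (LCFib lt (t.erase m) m p) := by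
    intro p hp
    rcases hg.2 with ⟨a, ha, ham, h⟩ | ⟨h, h'⟩
    · exact LC_caseI lt _ m p hp a ha ham h
    · exact LC_caseII hdim lt _ m p hp h h'
  have key := LC_fib hs (LCFib lt (t.erase m) m) (LC_open_total lt _ m)
    (fun p hp => (hc p hp).1) (fun p hp => (hc p hp).2)
  have := key.image (fun z : (Fin 4 → ℝ × E) × (ℝ × E) => Function.update z.1 m z.2)
    (Continuous.continuousOn (continuous_fst.update m continuous_snd))
  convert this using 1
  ext p
  constructor
  · intro hp
    refine ⟨(p, p m), ⟨?_, ?_⟩, by simp⟩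
    · intro i hi j hj hij
      exact hp i (Finset.mem_of_mem_erase hi) j (Finset.mem_of_mem_erase hj) hij
    · intro i hi
      have hne := Finset.ne_of_mem_erase hi
      have h1 := hp i (Finset.mem_of_mem_erase hi) m hm hne
      refine ⟨h1.1, fun h => ?_⟩
      have := h1.2 h (hg.1 i hi)
      simp only
      rwa [abs_sub_comm, norm_sub_rev]
  · rintro ⟨⟨q, y⟩, ⟨hq, hy⟩, rfl⟩
    simp only at hq hy ⊢
    intro i hi j hj hij
    by_cases him : i = m
    · subst him
      have hji : j ≠ i := hij.symm
      have hj' := Finset.mem_erase.2 ⟨hji, hj⟩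
      simp only [Function.update_self, Function.update_of_ne hji]
      have h1 := hg.1 j hj'
      refine ⟨fun h => by simp [h1] at h, fun _ h => (hy j hj').2 h⟩
    · have hi' := Finset.mem_erase.2 ⟨him, hi⟩
      by_cases hjm : j = m
      · subst hjm
        simp only [Function.update_self, Function.update_of_ne him]
        refine ⟨(hy i hi').1, fun h _ => ?_⟩
        rw [abs_sub_comm, norm_sub_rev]
        exact (hy i hi').2 h
      · simp only [Function.update_of_ne him, Function.update_of_ne hjm]
        exact hq i hi' j (Finset.mem_erase.2 ⟨hjm, hj⟩) hij

/-- Time reversal. -/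
theorem LC_reverse (lt : Fin 4 → Fin 4 → Bool) (t : Finset (Fin 4))
    (h : IsPreconnected (LCConf E lt t)) : IsPreconnected (LCConf E (fun i j => lt j i) t) := by
  have := h.image (fun p : Fin 4 → ℝ × E => fun i => (-(p i).1, (p i).2))
    (Continuous.continuousOn (by fun_prop))
  convert this using 1
  have aux : ∀ (l : Fin 4 → Fin 4 → Bool) (p : Fin 4 → ℝ × E), p ∈ LCConf E l t →
      (fun i => (-(p i).1, (p i).2)) ∈ LCConf E (fun i j => l j i) t := by
    intro l p hp i hi j hj hij
    have h1 := hp j hj i hi hij.symm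
    simp only
    refine ⟨fun h => ?_, fun h h' => ?_⟩
    · have := h1.1 h
      rw [norm_sub_rev]
      linarith
    · have := h1.2 h h'
      rw [norm_sub_rev]
      convert this using 2
      ring
  ext p
  constructor
  · intro hp
    exact ⟨_, aux _ p hp, by ext i <;> simp⟩
  · rintro ⟨q, hq, rfl⟩
    exact aux _ q hq

theorem LC_main (hdim : 1 < Module.rank ℝ E) (lt : Fin 4 → Fin 4 → Bool)
    (has : ∀ i j, lt i j = true → lt j i = false)
    (hcomb : ∀ t : Finset (Fin 4), t.Nonempty → ∃ m ∈ t,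
      LCGood lt (t.erase m) m ∨ LCGood (fun i j => lt j i) (t.erase m) m)
    (t : Finset (Fin 4)) : IsPreconnected (LCConf E lt t) := by
  induction t using Finset.strongInduction with
  | H t ih =>
    rcases t.eq_empty_or_nonempty with rfl | ht
    · have : LCConf E lt ∅ = univ := by ext; simp [LCConf]
      rw [this]
      exact isPreconnected_univ
    obtain ⟨m, hm, hg | hg⟩ := hcomb t ht
    · exact LC_step hdim lt has t m hm hg (ih _ (Finset.erase_ssubset hm))
    · exact LC_reverse _ t (LC_step hdim (fun i j => lt j i) (fun i j h => has j i h) t m hm hg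
        (LC_reverse _ _ (ih _ (Finset.erase_ssubset hm))))

end

theorem stmt_10 {E : Type*} [NormedAddCommGroup E] [InnerProductSpace ℝ E]
    (hdim : 2 ≤ Module.rank ℝ E)
    (R : Fin 4 → Fin 4 → (ℝ × E) → (ℝ × E) → Prop)
    (hR : ∀ i j : Fin 4, i < j →
      R i j = (fun x y => y.1 - x.1 > ‖y.2 - x.2‖) ∨
      R i j = (fun x y => x.1 - y.1 > ‖x.2 - y.2‖) ∨
      R i j = (fun x y => |x.1 - y.1| < ‖x.2 - y.2‖)) :
    IsPreconnected {p : Fin 4 → ℝ × E | ∀ i j : Fin 4, i < j → R i j (p i) (p j)} := by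
  have hdim' : 1 < Module.rank ℝ E := lt_of_lt_of_le (by norm_num) hdim
  have hk : ∀ i j : Fin 4, ∃ k : Fin 3, i < j →
      (k = 0 ∧ R i j = (fun x y => y.1 - x.1 > ‖y.2 - x.2‖)) ∨
      (k = 1 ∧ R i j = (fun x y => x.1 - y.1 > ‖x.2 - y.2‖)) ∨
      (k = 2 ∧ R i j = (fun x y => |x.1 - y.1| < ‖x.2 - y.2‖)) := by
    intro i j
    by_cases hij : i < j
    · rcases hR i j hij with h | h | h
      · exact ⟨0, fun _ => Or.inl ⟨rfl, h⟩⟩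
      · exact ⟨1, fun _ => Or.inr (Or.inl ⟨rfl, h⟩)⟩
      · exact ⟨2, fun _ => Or.inr (Or.inr ⟨rfl, h⟩)⟩
    · exact ⟨0, fun h => absurd h hij⟩
  choose k hk using hk
  have hlt1 : ∀ i j : Fin 4, i < j →
      LCltOf (k 0 1) (k 0 2) (k 0 3) (k 1 2) (k 1 3) (k 2 3) i j = (k i j == 0) := by
    intro i j hij
    fin_cases i <;> fin_cases j <;> first | rfl | (exact absurd hij (by decide))
  have hlt2 : ∀ i j : Fin 4, i < j →
      LCltOf (k 0 1) (k 0 2) (k 0 3) (k 1 2) (k 1 3) (k 2 3) j i = (k i j == 1) := by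
    intro i j hij
    fin_cases i <;> fin_cases j <;> first | rfl | (exact absurd hij (by decide))
  have hlt3 : ∀ i : Fin 4,
      LCltOf (k 0 1) (k 0 2) (k 0 3) (k 1 2) (k 1 3) (k 2 3) i i = false := by
    intro i
    fin_cases i <;> rfl
  have hcomb := LC_comb (k 0 1) (k 0 2) (k 0 3) (k 1 2) (k 1 3) (k 2 3)
  generalize LCltOf (k 0 1) (k 0 2) (k 0 3) (k 1 2) (k 1 3) (k 2 3) = lt at *
  have has : ∀ i j, lt i j = true → lt j i = false := by
    intro i j h
    rcases lt_trichotomy i j with hij | rfl | hij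
    · rw [hlt1 i j hij, beq_iff_eq] at h
      rw [hlt2 i j hij, h]; rfl
    · simp [hlt3] at h
    · rw [hlt2 j i hij, beq_iff_eq] at h
      rw [hlt1 j i hij, h]; rfl
  have hset : {p : Fin 4 → ℝ × E | ∀ i j : Fin 4, i < j → R i j (p i) (p j)} =
      LCConf E lt Finset.univ := by
    ext p
    have pair : ∀ i j : Fin 4, i < j → (R i j (p i) (p j) ↔
        (lt i j = true → ‖(p j).2 - (p i).2‖ < (p j).1 - (p i).1) ∧
        (lt j i = true → ‖(p i).2 - (p j).2‖ < (p i).1 - (p j).1) ∧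
        (lt i j = false → lt j i = false → |(p i).1 - (p j).1| < ‖(p i).2 - (p j).2‖)) := by
      intro i j hij
      rw [hlt1 i j hij, hlt2 i j hij]
      rcases hk i j hij with ⟨h, h'⟩ | ⟨h, h'⟩ | ⟨h, h'⟩ <;> rw [h, h'] <;> simp
    simp only [mem_ofPred_eq, LCConf, Finset.mem_univ, true_imp_iff]
    constructor
    · intro h i j hij
      rcases lt_or_gt_of_ne hij with hlt | hlt
      · have := (pair i j hlt).1 (h i j hlt)
        exact ⟨this.1, this.2.2⟩
      · have := (pair j i hlt).1 (h j i hlt)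
        refine ⟨this.2.1, fun h1 h2 => ?_⟩
        rw [abs_sub_comm, norm_sub_rev]
        exact this.2.2 h2 h1
    · intro h i j hij
      exact (pair i j hij).2 ⟨(h i j hij.ne).1, (h j i hij.ne').1, (h i j hij.ne).2⟩
  rw [hset]
  rcases (LCConf E lt Finset.univ).eq_empty_or_nonempty with he | ⟨p, hp⟩
  · rw [he]; exact isPreconnected_empty
  refine LC_main hdim' lt has (hcomb ?_) _
  intro i j hij l hjl
  have nij : i ≠ j := by rintro rfl; simp [hlt3] at hij
  have njl : j ≠ l := by rintro rfl; simp [hlt3] at hjl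
  have nil : i ≠ l := by rintro rfl; simp [has i j hij] at hjl
  have h1 := (hp i (Finset.mem_univ _) j (Finset.mem_univ _) nij).1 hij
  have h2 := (hp j (Finset.mem_univ _) l (Finset.mem_univ _) njl).1 hjl
  have h3 : ‖(p l).2 - (p i).2‖ ≤ ‖(p l).2 - (p j).2‖ + ‖(p j).2 - (p i).2‖ := by
    simpa using norm_add_le ((p l).2 - (p j).2) ((p j).2 - (p i).2)
  by_contra hil
  have hil : lt i l = false := by simpa using hil
  cases hli : lt l i
  · have h4 := abs_lt.1 ((hp i (Finset.mem_univ _) l (Finset.mem_univ _) nil).2 hil hli)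
    rw [norm_sub_rev] at h4
    linarith
  · have h4 := (hp l (Finset.mem_univ _) i (Finset.mem_univ _) nil.symm).1 hli
    have := norm_nonneg ((p i).2 - (p l).2)
    have := norm_nonneg ((p l).2 - (p i).2)
    linarith
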